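/- arXiv:2111.10727 — 5 statements merged into one kernel-verified Lean document; each statement's English description precedes it below -/
import Mathlib

section
/- Let f : ℝ → ℝ be bounded, integrable, supported in [−1,1], and satisfy ∫_{−1}^{1} f(s) ds = 0, and define Φ(x,z) = −(1/(2π)) ∫_{−1}^{1} ln((x−s)² + z²) f(s) ds. Then Φ is bounded on the closed lower half-plane {(x,z) : z ≤ 0} and Φ(x,z) → 0 as x² + z² → ∞. -/
open MeasureTheory intervalIntegral

/-- The two-dimensional logarithmic single-layer potential
`Φ(x,z) = −(1/(2π)) ∫_{−1}^{1} ln((x−s)² + z²) f(s) ds`. -/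
noncomputable def logPotential (f : ℝ → ℝ) (p : ℝ × ℝ) : ℝ :=
  -(1 / (2 * Real.pi)) * ∫ s in (-1:ℝ)..1, Real.log ((p.1 - s)^2 + p.2^2) * f s

/-- Far from `[-1, 1]` the logarithmic kernel is `O(1 / r)`-close to its value at the origin. -/
lemma abs_log_sub_log_sq_le {x z r s : ℝ} (hr : 8 ≤ r) (hxz : x ^ 2 + z ^ 2 = r ^ 2)
    (hs : |s| ≤ 1) :
    |Real.log ((x - s) ^ 2 + z ^ 2) - Real.log (r ^ 2)| ≤ 6 / r ∧
      0 < (x - s) ^ 2 + z ^ 2 := by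
  have hr0 : 0 < r := by linarith
  have hx : |x| ≤ r := abs_le_of_sq_le_sq (by nlinarith [sq_nonneg z]) hr0.le
  have hxs : |x * s| ≤ r := by
    rw [abs_mul]
    nlinarith [abs_nonneg x, abs_nonneg s]
  have hs2 : s ^ 2 ≤ 1 := by
    rw [← sq_abs]
    nlinarith [abs_nonneg s]
  obtain ⟨h1, h2⟩ := abs_le.1 hxs
  set A := (x - s) ^ 2 + z ^ 2 with hA
  have hAB : A = r ^ 2 + s ^ 2 - 2 * (x * s) := by rw [hA, ← hxz]; ring
  have hA1 : r ^ 2 / 2 ≤ A := by nlinarith [sq_nonneg s]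
  have hB : 0 < r ^ 2 := by positivity
  have hA0 : 0 < A := by linarith
  refine ⟨?_, hA0⟩
  have key : 6 / r * (r ^ 2 / 2) = 3 * r := by field_simp; ring
  have h6 : 0 < 6 / r := by positivity
  rw [abs_le]
  constructor
  · have h := Real.log_le_sub_one_of_pos (div_pos hB hA0)
    rw [Real.log_div hB.ne' hA0.ne'] at h
    have : r ^ 2 / A ≤ 1 + 6 / r := by
      rw [div_le_iff₀ hA0]
      nlinarith [mul_le_mul_of_nonneg_left hA1 h6.le, sq_nonneg s]
    linarith
  · have h := Real.log_le_sub_one_of_pos (div_pos hA0 hB)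
    rw [Real.log_div hA0.ne' hB.ne'] at h
    have : A / r ^ 2 ≤ 1 + 6 / r := by
      rw [div_le_iff₀ hB]
      nlinarith
    linarith

/-- Prefactor `1 / (2π)` is at most one. -/
lemma abs_logPotential_le (f : ℝ → ℝ) (x z : ℝ) :
    |logPotential f (x, z)| ≤ |∫ s in (-1:ℝ)..1, Real.log ((x - s) ^ 2 + z ^ 2) * f s| := by
  have hpi : |-(1 / (2 * Real.pi))| ≤ 1 := by
    rw [abs_neg, abs_of_pos (by positivity), div_le_one (by positivity)]
    linarith [Real.pi_gt_three]
  rw [logPotential, abs_mul]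
  exact mul_le_of_le_one_left (abs_nonneg _) hpi

/-- The potential of a bounded density of zero mean decays like `1 / r`. -/
lemma abs_logPotential_le_div {f : ℝ → ℝ} (hf : Integrable f) {C : ℝ} (hC : ∀ s, |f s| ≤ C)
    (hmean : (∫ s in (-1:ℝ)..1, f s) = 0) {x z r : ℝ} (hr : 8 ≤ r)
    (hxz : x ^ 2 + z ^ 2 = r ^ 2) : |logPotential f (x, z)| ≤ 12 * C / r := by
  refine (abs_logPotential_le f x z).trans ?_
  have hfi : IntervalIntegrable f volume (-1) 1 := hf.intervalIntegrable
  have hmem : ∀ s ∈ Set.uIcc (-1:ℝ) 1, |s| ≤ 1 := fun s hs => by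
    rw [Set.uIcc_of_le (by norm_num)] at hs
    exact abs_le.2 hs
  have hcont : ContinuousOn (fun s => Real.log ((x - s) ^ 2 + z ^ 2)) (Set.uIcc (-1:ℝ) 1) :=
    ContinuousOn.log (by fun_prop) fun s hs => (abs_log_sub_log_sq_le hr hxz (hmem s hs)).2.ne'
  have hint : (∫ s in (-1:ℝ)..1, Real.log ((x - s) ^ 2 + z ^ 2) * f s) =
      ∫ s in (-1:ℝ)..1, (Real.log ((x - s) ^ 2 + z ^ 2) - Real.log (r ^ 2)) * f s := by
    simp only [sub_mul]
    rw [intervalIntegral.integral_sub (hfi.continuousOn_mul hcont) (hfi.const_mul _),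
      intervalIntegral.integral_const_mul, hmean, mul_zero, sub_zero]
  rw [hint]
  have h := intervalIntegral.norm_integral_le_of_norm_le_const (a := -1) (b := 1) (C := 6 / r * C)
    (f := fun s => (Real.log ((x - s) ^ 2 + z ^ 2) - Real.log (r ^ 2)) * f s) fun s hs => by
      rw [norm_mul]
      exact mul_le_mul (abs_log_sub_log_sq_le hr hxz (hmem s (Set.uIoc_subset_uIcc hs))).1 (hC s)
        (abs_nonneg _) (by positivity)
  rw [Real.norm_eq_abs] at h
  refine h.trans (le_of_eq ?_)
  norm_num
  ring

/-- The logarithmic kernel is dominated by an integrable one, uniformly in `z`. -/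
lemma abs_log_sq_add_sq_le {t : ℝ} (ht : t ≠ 0) (z : ℝ) :
    |Real.log (t ^ 2 + z ^ 2)| ≤ t ^ 2 + z ^ 2 + 2 * |Real.log t| := by
  have ht2 : 0 < t ^ 2 := by positivity
  have hz := sq_nonneg z
  have hlow : 2 * Real.log t ≤ Real.log (t ^ 2 + z ^ 2) := by
    have := Real.log_le_log ht2 (le_add_of_nonneg_right hz)
    rwa [Real.log_pow] at this
  have hup := Real.log_le_sub_one_of_pos (add_pos_of_pos_of_nonneg ht2 hz)
  rw [abs_le]
  constructor <;> linarith [neg_abs_le (Real.log t), abs_nonneg (Real.log t)]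

/-- The potential of a bounded density is bounded on bounded sets. -/
lemma exists_abs_logPotential_le_of_sq_add_sq_le {f : ℝ → ℝ} {C : ℝ} (hC : ∀ s, |f s| ≤ C)
    (R : ℝ) : ∃ K, ∀ x z : ℝ, x ^ 2 + z ^ 2 ≤ R → |logPotential f (x, z)| ≤ K := by
  have hlog : ∀ a b : ℝ, IntervalIntegrable (fun u => |Real.log u|) volume a b := fun a b =>
    intervalIntegral.intervalIntegrable_log'.abs
  have hC0 : 0 ≤ C := (abs_nonneg _).trans (hC 0)
  refine ⟨2 * ((2 * R + 2) * C) +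
    2 * C * ∫ u in (-(R + 2))..(R + 2), |Real.log u|, fun x z hxz => ?_⟩
  refine (abs_logPotential_le f x z).trans ?_
  have hx : |x| ≤ R + 1 := by
    rw [← sq_abs] at hxz
    nlinarith [sq_nonneg z, sq_nonneg (|x| - 1), abs_nonneg x]
  obtain ⟨hx1, hx2⟩ := abs_le.1 hx
  have hshift : IntervalIntegrable (fun s => |Real.log (x - s)|) volume (-1) 1 := by
    simpa using (hlog (x + 1) (x - 1)).comp_sub_left x
  have hbound : IntervalIntegrable
      (fun s => (2 * R + 2) * C + 2 * C * |Real.log (x - s)|) volume (-1) 1 :=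
    intervalIntegrable_const.add (hshift.const_mul _)
  have h := intervalIntegral.norm_integral_le_of_norm_le (a := -1) (b := 1) (by norm_num)
    (f := fun s => Real.log ((x - s) ^ 2 + z ^ 2) * f s)
    (g := fun s => (2 * R + 2) * C + 2 * C * |Real.log (x - s)|) (μ := volume) (by
      filter_upwards [(Set.countable_singleton x).ae_notMem volume] with s hsx hs
      have ht : x - s ≠ 0 := sub_ne_zero.2 fun h => hsx h.symm
      have hs2 : s ^ 2 ≤ 1 := by nlinarith [hs.1, hs.2]
      rw [norm_mul, Real.norm_eq_abs, Real.norm_eq_abs]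
      calc |Real.log ((x - s) ^ 2 + z ^ 2)| * |f s|
          ≤ ((2 * R + 2) + 2 * |Real.log (x - s)|) * C := by
            refine mul_le_mul ((abs_log_sq_add_sq_le ht z).trans ?_) (hC s) (abs_nonneg _) ?_
            · nlinarith [sq_nonneg (x + s), sq_nonneg z]
            · nlinarith [sq_nonneg x, sq_nonneg z, abs_nonneg (Real.log (x - s))]
        _ = _ := by ring) hbound
  rw [Real.norm_eq_abs] at h
  refine h.trans ?_
  rw [intervalIntegral.integral_add intervalIntegrable_const (hshift.const_mul _),
    intervalIntegral.integral_const, intervalIntegral.integral_const_mul,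
    intervalIntegral.integral_comp_sub_left (fun u => |Real.log u|) x]
  have hmono : (∫ u in (x - 1)..(x - -1), |Real.log u|) ≤
      ∫ u in (-(R + 2))..(R + 2), |Real.log u| :=
    intervalIntegral.integral_mono_interval (by linarith) (by linarith) (by linarith)
      (Filter.Eventually.of_forall fun u => abs_nonneg _) (hlog _ _)
  have := mul_le_mul_of_nonneg_left hmono (by positivity : 0 ≤ 2 * C)
  rw [smul_eq_mul]
  linarith

/-- if `f` is bounded, integrable, supported in `[-1,1]` and has zero mean, then
`Φ` is bounded on the closed lower half-plane `{z ≤ 0}` and `Φ(x,z) → 0` as `x² + z² → ∞`. -/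
theorem logPotential_bounded_and_decays
    (f : ℝ → ℝ) (hf : Integrable f) (hbd : ∃ C : ℝ, ∀ s : ℝ, |f s| ≤ C)
    (hsupp : ∀ s : ℝ, s ∉ Set.Icc (-1:ℝ) 1 → f s = 0)
    (hmean : (∫ s in (-1:ℝ)..1, f s) = 0) :
    (∃ C : ℝ, ∀ x z : ℝ, z ≤ 0 → |logPotential f (x, z)| ≤ C) ∧
      (∀ ε : ℝ, 0 < ε → ∃ R : ℝ, ∀ x z : ℝ, R < x^2 + z^2 → |logPotential f (x, z)| < ε) := by
  obtain ⟨C, hC⟩ := hbd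
  have hdecay : ∀ ε : ℝ, 0 < ε →
      ∃ R : ℝ, ∀ x z : ℝ, R < x^2 + z^2 → |logPotential f (x, z)| < ε := by
    intro ε hε
    refine ⟨max 8 (12 * C / ε) ^ 2, fun x z h => ?_⟩
    have hr : max 8 (12 * C / ε) < √(x ^ 2 + z ^ 2) := Real.lt_sqrt_of_sq_lt h
    obtain ⟨h8, hCε⟩ := max_lt_iff.1 hr
    refine (abs_logPotential_le_div hf hC hmean h8.le (Real.sq_sqrt (by positivity)).symm).trans_lt
      ?_
    rw [div_lt_iff₀ hε] at hCε
    rw [div_lt_iff₀ (by linarith)]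
    linarith
  refine ⟨?_, hdecay⟩
  obtain ⟨R, hR⟩ := hdecay 1 one_pos
  obtain ⟨K, hK⟩ := exists_abs_logPotential_le_of_sq_add_sq_le hC R
  refine ⟨max K 1, fun x z _ => ?_⟩
  rcases le_or_gt (x ^ 2 + z ^ 2) R with h | h
  · exact (hK x z h).trans (le_max_left _ _)
  · exact (hR x z h).le.trans (le_max_right _ _)
end

section
/- For every integer j ≥ 1, the polynomial q_j = (p_j − β_j p_{j+2})/α_j satisfies q_j'(1) = 0, q_j'(−1) = 0, ∫_{−1}^{1} q_j(x) dx = 0, and ∫_{−1}^{1} q_j(x)² dx = 1. -/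
open MeasureTheory intervalIntegral

/-- Normalized Legendre polynomial on `[-1,1]`:
`p_n(x) = √(n + 1/2) · (1/(2ⁿ n!)) · (d/dx)ⁿ (x² − 1)ⁿ`, so `∫_{-1}^1 p_m p_n = δ_{mn}`. -/
noncomputable def legP (n : ℕ) (x : ℝ) : ℝ :=
  Real.sqrt ((n : ℝ) + 1/2) * (1 / ((2:ℝ)^n * (Nat.factorial n : ℝ))) *
    iteratedDeriv n (fun y : ℝ => (y^2 - 1)^n) x

/-- `β_j = j(j+1)√(2j+1) / ((j+2)(j+3)√(2j+5))`. -/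
noncomputable def betaC (j : ℕ) : ℝ :=
  ((j:ℝ) * ((j:ℝ) + 1) * Real.sqrt (2*(j:ℝ) + 1)) /
    (((j:ℝ) + 2) * ((j:ℝ) + 3) * Real.sqrt (2*(j:ℝ) + 5))

/-- `α_j = √(1 + β_j²)`. -/
noncomputable def alphaC (j : ℕ) : ℝ := Real.sqrt (1 + (betaC j)^2)

/-- `q_j = (p_j − β_j p_{j+2}) / α_j`. -/
noncomputable def qP (j : ℕ) (x : ℝ) : ℝ := (legP j x - betaC j * legP (j+2) x) / alphaC j

namespace Polynomial

/-- The (unnormalized) Rodrigues polynomial `(d/dx)ⁿ (x² − 1)ⁿ`. -/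
noncomputable def rodrigues (n : ℕ) : ℝ[X] := derivative^[n] ((X ^ 2 - 1) ^ n)

lemma iteratedDeriv_eval (p : ℝ[X]) (n : ℕ) :
    iteratedDeriv n (fun y : ℝ => p.eval y) = fun x => (derivative^[n] p).eval x := by
  induction n with
  | zero => simp
  | succ n ih =>
    rw [iteratedDeriv_succ, ih, Function.iterate_succ_apply']
    ext x
    exact Polynomial.deriv _

lemma intervalIntegrable_eval (p : ℝ[X]) (a b : ℝ) :
    IntervalIntegrable (fun x => p.eval x) volume a b :=
  p.continuous.intervalIntegrable a b

lemma integral_eval_derivative (p : ℝ[X]) (a b : ℝ) :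
    ∫ x in a..b, (derivative p).eval x = p.eval b - p.eval a :=
  integral_eq_sub_of_hasDerivAt (fun x _ => p.hasDerivAt x) (intervalIntegrable_eval _ a b)

lemma integral_eval_add (p q : ℝ[X]) (a b : ℝ) :
    ∫ x in a..b, (p + q).eval x = (∫ x in a..b, p.eval x) + ∫ x in a..b, q.eval x := by
  simp only [eval_add]
  exact integral_add (intervalIntegrable_eval _ a b) (intervalIntegrable_eval _ a b)

lemma integral_eval_C_mul (c : ℝ) (p : ℝ[X]) (a b : ℝ) :
    ∫ x in a..b, (C c * p).eval x = c * ∫ x in a..b, p.eval x := by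
  simp only [eval_mul, eval_C]
  exact intervalIntegral.integral_const_mul _ _

lemma eval_iterate_derivative_eq_coeff_taylor (p : ℝ[X]) (r : ℝ) (k : ℕ) :
    (derivative^[k] p).eval r = (k.factorial : ℝ) * (taylor r p).coeff k := by
  rw [taylor_coeff, ← factorial_smul_hasseDeriv]
  simp

lemma taylor_sq_sub_one_pow {r : ℝ} (hr : r ^ 2 = 1) (n : ℕ) :
    taylor r ((X ^ 2 - 1) ^ n) = (X + C (2 * r)) ^ n * X ^ n := by
  have h : taylor r (X ^ 2 - 1 : ℝ[X]) = (X + C (2 * r)) * X := by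
    have h1 : (C r : ℝ[X]) ^ 2 = 1 := by rw [← C_pow, hr, C_1]
    simp only [map_sub, taylor_pow, taylor_X, taylor_one, C_mul, C_1]
    have h2 : (C 2 : ℝ[X]) = 2 := rfl
    rw [h2]
    linear_combination h1
  rw [taylor_pow, h, mul_pow]

lemma eval_iterate_derivative_sq_sub_one_pow_of_lt {r : ℝ} (hr : r ^ 2 = 1) {k n : ℕ}
    (hk : k < n) : (derivative^[k] ((X ^ 2 - 1 : ℝ[X]) ^ n)).eval r = 0 := by
  rw [eval_iterate_derivative_eq_coeff_taylor, taylor_sq_sub_one_pow hr, coeff_mul_X_pow',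
    if_neg (by omega), mul_zero]

lemma eval_derivative_rodrigues {r : ℝ} (hr : r ^ 2 = 1) (n : ℕ) :
    (derivative (rodrigues n)).eval r =
      ((n + 1).factorial : ℝ) * ((2 * r) ^ (n - 1) * n) := by
  rw [rodrigues, ← Function.iterate_succ_apply' derivative, eval_iterate_derivative_eq_coeff_taylor,
    taylor_sq_sub_one_pow hr, coeff_mul_X_pow', if_pos (by omega), Nat.succ_sub (le_refl n),
    Nat.sub_self, coeff_X_add_C_pow]
  simp

/-- Repeated integration by parts against `(x² − 1)ⁿ`. -/
lemma integral_iterate_derivative_sq_sub_one_pow_mul (n k : ℕ) (hk : k ≤ n) (f : ℝ[X]) :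
    ∫ x in (-1 : ℝ)..1, (derivative^[k] ((X ^ 2 - 1) ^ n) * f).eval x =
      (-1) ^ k * ∫ x in (-1 : ℝ)..1, ((X ^ 2 - 1) ^ n * derivative^[k] f).eval x := by
  induction k generalizing f with
  | zero => simp
  | succ k ih =>
    have h := integral_eval_derivative (derivative^[k] ((X ^ 2 - 1) ^ n) * f) (-1) 1
    rw [derivative_mul, integral_eval_add, eval_mul, eval_mul,
      eval_iterate_derivative_sq_sub_one_pow_of_lt (by norm_num) hk,
      eval_iterate_derivative_sq_sub_one_pow_of_lt (by norm_num) hk, ih (by omega)] at h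
    rw [Function.iterate_succ_apply', Function.iterate_succ_apply, pow_succ (-1 : ℝ)]
    linear_combination h

lemma natDegree_sq_sub_one_pow (n : ℕ) : ((X ^ 2 - 1 : ℝ[X]) ^ n).natDegree = 2 * n := by
  rw [natDegree_pow, ← C_1, natDegree_X_pow_sub_C, mul_comm]

lemma iterate_derivative_two_mul_sq_sub_one_pow (n : ℕ) :
    derivative^[2 * n] ((X ^ 2 - 1 : ℝ[X]) ^ n) = C ((2 * n).factorial : ℝ) := by
  have hm : ((X ^ 2 - 1 : ℝ[X]) ^ n).Monic := by
    rw [← C_1]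
    exact (monic_X_pow_sub_C 1 two_ne_zero).pow n
  have hdeg := natDegree_iterate_derivative ((X ^ 2 - 1 : ℝ[X]) ^ n) (2 * n)
  rw [natDegree_sq_sub_one_pow, Nat.sub_self, Nat.le_zero] at hdeg
  rw [eq_C_of_natDegree_eq_zero hdeg, coeff_iterate_derivative, zero_add,
    Nat.descFactorial_self, ← natDegree_sq_sub_one_pow n, hm.coeff_natDegree]
  simp

lemma integral_sq_sub_one_pow (n : ℕ) :
    ∫ x in (-1 : ℝ)..1, ((X ^ 2 - 1 : ℝ[X]) ^ n).eval x =
      (-1) ^ n * (2 ^ (2 * n + 1) * (n.factorial : ℝ) ^ 2 / ((2 * n + 1).factorial : ℝ)) := by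
  induction n with
  | zero => norm_num
  | succ n ih =>
    have h := integral_eval_derivative (X * (X ^ 2 - 1) ^ (n + 1)) (-1) 1
    have hd : derivative (X * (X ^ 2 - 1 : ℝ[X]) ^ (n + 1)) =
        C (2 * n + 3 : ℝ) * (X ^ 2 - 1) ^ (n + 1) + C (2 * n + 2 : ℝ) * (X ^ 2 - 1) ^ n := by
      have h2 : (C 2 : ℝ[X]) = 2 := rfl
      have h3 : (C 3 : ℝ[X]) = 3 := rfl
      simp only [derivative_mul, derivative_X, derivative_pow_succ, derivative_sub,
        derivative_one, C_add, C_mul, C_1, h2, h3, map_natCast]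
      push_cast
      ring
    rw [hd, integral_eval_add, integral_eval_C_mul, integral_eval_C_mul, ih] at h
    have h0 : ((2 * n + 1).factorial : ℝ) ≠ 0 := by positivity
    have h1 : (2 * n + 3 : ℝ) ≠ 0 := by positivity
    have h2 : (2 * n + 2 : ℝ) ≠ 0 := by positivity
    have hf : ((2 * (n + 1) + 1).factorial : ℝ) =
        (2 * n + 3) * ((2 * n + 2) * (2 * n + 1).factorial) := by
      rw [show 2 * (n + 1) + 1 = (2 * n + 1) + 1 + 1 by ring, Nat.factorial_succ,
        Nat.factorial_succ]
      push_cast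
      ring
    rw [hf, Nat.factorial_succ]
    simp only [eval_mul, eval_pow, eval_sub, eval_X, eval_one] at h
    norm_num at h
    simp only [eval_pow, eval_sub, eval_X, eval_one]
    apply mul_left_cancel₀ h1
    push_cast
    rw [eq_neg_of_add_eq_zero_left h]
    field_simp
    ring

lemma integral_rodrigues_mul_of_natDegree_lt {n : ℕ} {f : ℝ[X]} (hf : f.natDegree < n) :
    ∫ x in (-1 : ℝ)..1, (rodrigues n * f).eval x = 0 := by
  rw [rodrigues, integral_iterate_derivative_sq_sub_one_pow_mul n n le_rfl,
    iterate_derivative_eq_zero hf]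
  simp

lemma natDegree_rodrigues_le (n : ℕ) : (rodrigues n).natDegree ≤ n := by
  have h := natDegree_iterate_derivative ((X ^ 2 - 1 : ℝ[X]) ^ n) n
  rw [natDegree_sq_sub_one_pow] at h
  exact h.trans (by omega)

lemma integral_rodrigues_mul_self (n : ℕ) :
    ∫ x in (-1 : ℝ)..1, (rodrigues n * rodrigues n).eval x =
      2 ^ (2 * n + 1) * (n.factorial : ℝ) ^ 2 / (2 * n + 1) := by
  have h1 : derivative^[n] (rodrigues n) = C ((2 * n).factorial : ℝ) := by
    rw [rodrigues, ← Function.iterate_add_apply, ← two_mul,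
      iterate_derivative_two_mul_sq_sub_one_pow]
  nth_rw 1 [rodrigues]
  rw [integral_iterate_derivative_sq_sub_one_pow_mul n n le_rfl, h1, mul_comm _ (C _),
    integral_eval_C_mul, integral_sq_sub_one_pow, Nat.factorial_succ]
  have h0 : ((2 * n).factorial : ℝ) ≠ 0 := by positivity
  have hs : ((-1 : ℝ) ^ n) ^ 2 = 1 := by rw [← pow_mul, mul_comm, pow_mul]; norm_num
  push_cast
  field_simp
  rw [hs]

end Polynomial

open Polynomial

/-- The normalizing constant of the Legendre polynomial of degree `n`. -/
noncomputable def legendreScale (n : ℕ) : ℝ :=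
  √((n : ℝ) + 1 / 2) * (1 / ((2 : ℝ) ^ n * (n.factorial : ℝ)))

lemma legP_eq_eval (n : ℕ) (x : ℝ) : legP n x = (C (legendreScale n) * rodrigues n).eval x := by
  have h := congrFun (iteratedDeriv_eval ((X ^ 2 - 1) ^ n) n) x
  simp only [eval_pow, eval_sub, eval_X, eval_one] at h
  rw [legP, h, eval_mul, eval_C, rodrigues, legendreScale]

lemma deriv_legP {r : ℝ} (hr : r ^ 2 = 1) {n : ℕ} (hn : 1 ≤ n) :
    deriv (legP n) r = √((n : ℝ) + 1 / 2) * (n * (n + 1) / 2) * r ^ (n - 1) := by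
  obtain ⟨m, rfl⟩ := Nat.exists_eq_add_of_le' hn
  rw [funext (legP_eq_eval (m + 1)), Polynomial.deriv, derivative_C_mul, eval_mul, eval_C,
    eval_derivative_rodrigues hr, legendreScale, Nat.factorial_succ (m + 1), mul_pow,
    Nat.add_sub_cancel]
  have h0 : ((m + 1).factorial : ℝ) ≠ 0 := by positivity
  push_cast
  field_simp
  ring

lemma continuous_legP (n : ℕ) : Continuous (legP n) := by
  rw [funext (legP_eq_eval n)]
  exact Polynomial.continuous _

lemma differentiable_legP (n : ℕ) : Differentiable ℝ (legP n) := by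
  rw [funext (legP_eq_eval n)]
  exact Polynomial.differentiable _

lemma integral_legP {n : ℕ} (hn : 1 ≤ n) : ∫ x in (-1 : ℝ)..1, legP n x = 0 := by
  simp only [legP_eq_eval]
  rw [integral_eval_C_mul, ← mul_one (rodrigues n),
    integral_rodrigues_mul_of_natDegree_lt (by rw [natDegree_one]; omega), mul_zero]

lemma integral_legP_mul_legP_of_lt {m n : ℕ} (h : m < n) :
    ∫ x in (-1 : ℝ)..1, legP n x * legP m x = 0 := by
  simp only [legP_eq_eval, ← eval_mul]
  have hmul : C (legendreScale n) * rodrigues n * (C (legendreScale m) * rodrigues m) =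
      C (legendreScale n * legendreScale m) * (rodrigues n * rodrigues m) := by
    rw [C_mul]
    ring
  rw [hmul, integral_eval_C_mul,
    integral_rodrigues_mul_of_natDegree_lt ((natDegree_rodrigues_le m).trans_lt h), mul_zero]

lemma integral_legP_sq (n : ℕ) : ∫ x in (-1 : ℝ)..1, legP n x ^ 2 = 1 := by
  simp only [legP_eq_eval, ← eval_pow]
  have hmul : (C (legendreScale n) * rodrigues n) ^ 2 =
      C (legendreScale n ^ 2) * (rodrigues n * rodrigues n) := by
    rw [C_pow]
    ring
  rw [hmul, integral_eval_C_mul, integral_rodrigues_mul_self, legendreScale, mul_pow,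
    Real.sq_sqrt (by positivity)]
  have h0 : (n.factorial : ℝ) ≠ 0 := by positivity
  field_simp
  ring

lemma betaC_mul_sqrt (j : ℕ) :
    betaC j * √(((j + 2 : ℕ) : ℝ) + 1 / 2) * (((j : ℝ) + 2) * (j + 3)) =
      √((j : ℝ) + 1 / 2) * (j * (j + 1)) := by
  have h1 : √(2 * (j : ℝ) + 1) = √2 * √((j : ℝ) + 1 / 2) := by
    rw [← Real.sqrt_mul (by norm_num)]
    congr 1
    ring
  have h2 : √(2 * (j : ℝ) + 5) = √2 * √(((j + 2 : ℕ) : ℝ) + 1 / 2) := by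
    rw [← Real.sqrt_mul (by norm_num)]
    congr 1
    push_cast
    ring
  have h3 : √(((j + 2 : ℕ) : ℝ) + 1 / 2) ≠ 0 := by positivity
  rw [betaC, h1, h2]
  field_simp

lemma deriv_qP {r : ℝ} (hr : r ^ 2 = 1) {j : ℕ} (hj : 1 ≤ j) : deriv (qP j) r = 0 := by
  have h : HasDerivAt (qP j)
      ((deriv (legP j) r - betaC j * deriv (legP (j + 2)) r) / alphaC j) r :=
    ((differentiable_legP j r).hasDerivAt.sub
      ((differentiable_legP (j + 2) r).hasDerivAt.const_mul (betaC j))).div_const (alphaC j)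
  have hpow : r ^ (j + 2 - 1) = r ^ (j - 1) := by
    rw [show j + 2 - 1 = j - 1 + 2 by omega, pow_add, hr, mul_one]
  rw [h.deriv, deriv_legP hr hj, deriv_legP hr (by omega), hpow, div_eq_zero_iff]
  left
  have hb := betaC_mul_sqrt j
  push_cast at hb ⊢
  linear_combination (-(r ^ (j - 1)) / 2) * hb

lemma integral_qP {j : ℕ} (hj : 1 ≤ j) : ∫ x in (-1 : ℝ)..1, qP j x = 0 := by
  simp only [qP]
  rw [intervalIntegral.integral_div, integral_sub ((continuous_legP j).intervalIntegrable _ _)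
    (((continuous_legP (j + 2)).intervalIntegrable _ _).const_mul _),
    intervalIntegral.integral_const_mul, integral_legP hj, integral_legP (by omega)]
  simp

lemma integral_qP_sq (j : ℕ) : ∫ x in (-1 : ℝ)..1, qP j x ^ 2 = 1 := by
  have hc := continuous_legP j
  have hc2 := continuous_legP (j + 2)
  have hexp : ∀ x, qP j x ^ 2 = (legP j x ^ 2 + betaC j ^ 2 * legP (j + 2) x ^ 2 -
      2 * betaC j * (legP (j + 2) x * legP j x)) / alphaC j ^ 2 := fun x => by
    rw [qP, div_pow]
    ring
  simp only [hexp]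
  rw [intervalIntegral.integral_div, intervalIntegral.integral_sub, intervalIntegral.integral_add,
    intervalIntegral.integral_const_mul, intervalIntegral.integral_const_mul, integral_legP_sq,
    integral_legP_sq, integral_legP_mul_legP_of_lt (by omega), alphaC,
    Real.sq_sqrt (by positivity), mul_one, mul_zero, sub_zero]
  · exact div_self (by positivity)
  all_goals exact Continuous.intervalIntegrable (by fun_prop) _ _

/-- for every `j ≥ 1`, the polynomial `q_j` satisfies `q_j'(1) = 0`,
`q_j'(−1) = 0`, `∫_{−1}^{1} q_j = 0`, and `∫_{−1}^{1} q_j² = 1`. -/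
theorem qP_properties (j : ℕ) (hj : 1 ≤ j) :
    deriv (qP j) 1 = 0 ∧ deriv (qP j) (-1) = 0 ∧
      (∫ x in (-1:ℝ)..1, qP j x) = 0 ∧ (∫ x in (-1:ℝ)..1, (qP j x)^2) = 1 :=
  ⟨deriv_qP (by norm_num) hj, deriv_qP (by norm_num) hj, integral_qP hj, integral_qP_sq j⟩
end

section
/- For all integers i, j ≥ 1 with i ≠ j one has ∫_{−1}^{1} q_i'(x) q_j'(x) dx = 0, while for i = j one has ∫_{−1}^{1} q_j'(x)² dx = (β_j √(2j+5) / (α_j² √(2j+1))) · (2j+1)(2j+3). -/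
open MeasureTheory intervalIntegral

/-- The Legendre polynomial `Pₙ`, normalized by `Pₙ(1) = 1`, via Rodrigues' formula. -/
noncomputable def legendrePoly (n : ℕ) : Polynomial ℝ :=
  Polynomial.C (1 / ((2:ℝ)^n * (Nat.factorial n : ℝ))) *
    Polynomial.derivative^[n] ((Polynomial.X^2 - 1)^n)

namespace legendrePoly

open Polynomial

theorem integral_eval_mul_derivative (p q : ℝ[X]) (a b : ℝ) :
    ∫ x in a..b, p.eval x * (derivative q).eval x =
      p.eval b * q.eval b - p.eval a * q.eval a - ∫ x in a..b, (derivative p).eval x * q.eval x :=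
  integral_mul_deriv_eq_deriv_mul (fun x _ => p.hasDerivAt x) (fun x _ => q.hasDerivAt x)
    ((derivative p).continuous.intervalIntegrable _ _)
    ((derivative q).continuous.intervalIntegrable _ _)

theorem integral_eval_mul_iterate_derivative_eq_zero {a b : ℝ} (f : ℝ[X]) (n : ℕ)
    (ha : ∀ k < n, (derivative^[k] f).eval a = 0) (hb : ∀ k < n, (derivative^[k] f).eval b = 0)
    (r : ℝ[X]) (hr : derivative^[n] r = 0) :
    ∫ x in a..b, r.eval x * (derivative^[n] f).eval x = 0 := by
  induction n generalizing r with
  | zero =>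
    simp only [Function.iterate_zero, id_eq] at hr
    simp [hr]
  | succ n ih =>
    rw [Function.iterate_succ_apply', integral_eval_mul_derivative,
      ha n n.lt_succ_self, hb n n.lt_succ_self,
      ih (fun k hk => ha k (hk.trans n.lt_succ_self)) (fun k hk => hb k (hk.trans n.lt_succ_self))
        (derivative r) (by rwa [← Function.iterate_succ_apply])]
    simp

theorem eval_iterate_derivative_eq_factorial_mul_coeff (p : ℝ[X]) (k : ℕ) (a : ℝ) :
    (derivative^[k] p).eval a = k.factorial * (taylor a p).coeff k := by
  rw [taylor_coeff, ← factorial_smul_hasseDeriv]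
  simp

theorem taylor_sq_sub_one_pow {a : ℝ} (ha : a^2 = 1) (n : ℕ) :
    taylor a ((X^2 - 1 : ℝ[X])^n) = X^n * (X + C (2*a))^n := by
  have h : (C a : ℝ[X])^2 = 1 := by rw [← C_pow, ha, C_1]
  rw [taylor_apply, ← mul_pow]
  simp only [pow_comp, sub_comp, X_comp, one_comp, C_mul, C_ofNat]
  congr 1
  linear_combination h

theorem eval_iterate_derivative_sq_sub_one_pow {a : ℝ} (ha : a^2 = 1) (n k : ℕ) :
    (derivative^[k] ((X^2 - 1 : ℝ[X])^n)).eval a =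
      if n ≤ k then k.factorial * ((2*a)^(n - (k - n)) * (n.choose (k - n))) else 0 := by
  rw [eval_iterate_derivative_eq_factorial_mul_coeff, taylor_sq_sub_one_pow ha, coeff_X_pow_mul']
  split_ifs
  · rw [coeff_X_add_C_pow]
  · simp

theorem eval_eq_pow {a : ℝ} (ha : a^2 = 1) (n : ℕ) : (legendrePoly n).eval a = a^n := by
  rw [legendrePoly, eval_mul, eval_C, eval_iterate_derivative_sq_sub_one_pow ha]
  have := n.factorial_ne_zero
  simp only [le_refl, if_true, Nat.sub_self, Nat.sub_zero, Nat.choose_zero_right, mul_pow]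
  field_simp
  simp

theorem eval_derivative_succ {a : ℝ} (ha : a^2 = 1) (n : ℕ) :
    (derivative (legendrePoly (n+1))).eval a = (n+1) * (n+2) / 2 * a^n := by
  rw [legendrePoly, derivative_C_mul, ← Function.iterate_succ_apply' derivative, eval_mul, eval_C,
    eval_iterate_derivative_sq_sub_one_pow ha]
  have := n.factorial_ne_zero
  simp only [Nat.succ_eq_add_one, Nat.le_succ, if_true, Nat.add_sub_cancel_left,
    Nat.add_sub_cancel, Nat.choose_one_right, mul_pow, Nat.factorial_succ]
  push_cast
  field_simp
  ring

theorem natDegree_le (n : ℕ) : (legendrePoly n).natDegree ≤ n := by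
  refine (natDegree_C_mul_le _ _).trans ((natDegree_iterate_derivative _ _).trans ?_)
  have h : ((X^2 - 1 : ℝ[X])^n).natDegree ≤ n * 2 := by
    refine natDegree_pow_le_of_le n ?_
    compute_degree
  omega

theorem integral_eval_mul_eq_zero (n : ℕ) (r : ℝ[X]) (hr : derivative^[n] r = 0) :
    ∫ x in (-1:ℝ)..1, r.eval x * (legendrePoly n).eval x = 0 := by
  have h := integral_eval_mul_iterate_derivative_eq_zero (a := -1) (b := 1) ((X^2 - 1)^n) n
    (fun k hk => by
      rw [eval_iterate_derivative_sq_sub_one_pow (by norm_num), if_neg (by omega)])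
    (fun k hk => by
      rw [eval_iterate_derivative_sq_sub_one_pow (by norm_num), if_neg (by omega)]) r hr
  simp only [legendrePoly, eval_mul, eval_C, mul_left_comm _ (1 / _ : ℝ)]
  rw [intervalIntegral.integral_const_mul, h, mul_zero]

theorem integral_derivative_mul_derivative {m n : ℕ} (hm : 1 ≤ m) (hmn : m ≤ n) :
    ∫ x in (-1:ℝ)..1, (derivative (legendrePoly m)).eval x * (derivative (legendrePoly n)).eval x =
      m * (m + 1) / 2 * (1 + (-1)^(m + n)) := by
  obtain ⟨m, rfl⟩ := Nat.exists_eq_add_of_le' hm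
  have hr : derivative^[n] (derivative (derivative (legendrePoly (m+1)))) = 0 := by
    rw [← Function.iterate_succ_apply, ← Function.iterate_succ_apply]
    exact iterate_derivative_eq_zero ((natDegree_le _).trans_lt (by omega))
  rw [integral_eval_mul_derivative, integral_eval_mul_eq_zero n _ hr,
    eval_derivative_succ (by norm_num), eval_derivative_succ (by norm_num),
    eval_eq_pow (by norm_num), eval_eq_pow (by norm_num)]
  push_cast
  ring

/-- `P_j - (j(j+1) / ((j+2)(j+3))) P_{j+2}`, a scalar multiple of `q_j`. -/
noncomputable def combination (j : ℕ) : ℝ[X] :=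
  legendrePoly j - C ((j:ℝ) * (j + 1) / ((j + 2) * (j + 3))) * legendrePoly (j + 2)

theorem integral_derivative_combination_left (j : ℕ) (p : ℝ[X]) :
    ∫ x in (-1:ℝ)..1, (derivative (combination j)).eval x * (derivative p).eval x =
      (∫ x in (-1:ℝ)..1, (derivative (legendrePoly j)).eval x * (derivative p).eval x) -
      (j:ℝ) * (j + 1) / ((j + 2) * (j + 3)) *
        ∫ x in (-1:ℝ)..1, (derivative (legendrePoly (j + 2))).eval x * (derivative p).eval x := by
  rw [← intervalIntegral.integral_const_mul, ← intervalIntegral.integral_sub]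
  · refine intervalIntegral.integral_congr fun x _ => ?_
    simp only [combination, derivative_sub, derivative_C_mul, eval_sub, eval_mul, eval_C]
    ring
  all_goals exact Continuous.intervalIntegrable (by fun_prop) _ _

theorem integral_derivative_combination_mul_legendrePoly {i n : ℕ} (hi : 1 ≤ i) (hn : i < n) :
    ∫ x in (-1:ℝ)..1, (derivative (combination i)).eval x *
      (derivative (legendrePoly n)).eval x = 0 := by
  rw [integral_derivative_combination_left, integral_derivative_mul_derivative hi hn.le]
  obtain rfl | hn' := (Nat.succ_le_of_lt hn).eq_or_lt
  · simp only [mul_comm ((derivative (legendrePoly (i + 2))).eval _)]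
    rw [integral_derivative_mul_derivative (by omega) (by omega)]
    rw [Odd.neg_one_pow ⟨i, by omega⟩, Odd.neg_one_pow ⟨i + 1, by omega⟩]
    simp
  · rw [integral_derivative_mul_derivative (by omega) (by omega)]
    push_cast
    field_simp
    ring

theorem integral_derivative_combination_of_lt {i j : ℕ} (hi : 1 ≤ i) (hij : i < j) :
    ∫ x in (-1:ℝ)..1, (derivative (combination i)).eval x *
      (derivative (combination j)).eval x = 0 := by
  simp only [mul_comm ((derivative (combination i)).eval _)]
  rw [integral_derivative_combination_left]
  simp only [mul_comm _ ((derivative (combination i)).eval _)]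
  rw [integral_derivative_combination_mul_legendrePoly hi hij,
    integral_derivative_combination_mul_legendrePoly hi (by omega)]
  simp

theorem integral_derivative_combination_of_ne {i j : ℕ} (hi : 1 ≤ i) (hj : 1 ≤ j) (hij : i ≠ j) :
    ∫ x in (-1:ℝ)..1, (derivative (combination i)).eval x *
      (derivative (combination j)).eval x = 0 := by
  obtain h | h := hij.lt_or_gt
  · exact integral_derivative_combination_of_lt hi h
  · simpa only [mul_comm] using integral_derivative_combination_of_lt hj h

theorem integral_derivative_combination_self {j : ℕ} (hj : 1 ≤ j) :
    ∫ x in (-1:ℝ)..1, (derivative (combination j)).eval x *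
      (derivative (combination j)).eval x =
      (j:ℝ) * (j + 1) / ((j + 2) * (j + 3)) * (4 * j + 6) := by
  rw [integral_derivative_combination_left]
  simp only [mul_comm _ ((derivative (combination j)).eval _)]
  rw [integral_derivative_combination_mul_legendrePoly (n := j + 2) hj (by omega),
    integral_derivative_combination_left,
    integral_derivative_mul_derivative hj le_rfl]
  simp only [mul_comm ((derivative (legendrePoly (j + 2))).eval _)]
  rw [integral_derivative_mul_derivative hj (by omega),
    Even.neg_one_pow ⟨j, rfl⟩, Even.neg_one_pow ⟨j + 1, by omega⟩]
  field_simp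
  ring

end legendrePoly

theorem iteratedDeriv_polynomial_eval (p : Polynomial ℝ) (n : ℕ) :
    iteratedDeriv n (fun x => p.eval x) = fun x => (Polynomial.derivative^[n] p).eval x := by
  induction n with
  | zero => simp
  | succ n ih =>
    ext x
    rw [iteratedDeriv_succ, ih, Polynomial.deriv, Function.iterate_succ_apply']

theorem legP_eq_eval_s6 (n : ℕ) (x : ℝ) :
    legP n x = Real.sqrt ((n : ℝ) + 1/2) * (legendrePoly n).eval x := by
  have h : (fun y : ℝ => (y^2 - 1)^n) =
      fun y => ((Polynomial.X^2 - 1 : Polynomial ℝ)^n).eval y := by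
    ext y
    simp
  rw [legP, h, iteratedDeriv_polynomial_eval, legendrePoly, Polynomial.eval_mul,
    Polynomial.eval_C, mul_assoc]

theorem sqrt_two_mul_add_one (n : ℕ) :
    Real.sqrt (2 * (n:ℝ) + 1) = Real.sqrt 2 * Real.sqrt ((n:ℝ) + 1/2) := by
  rw [← Real.sqrt_mul (by norm_num)]
  ring_nf

theorem deriv_qP_s6 (j : ℕ) (x : ℝ) :
    deriv (qP j) x = Real.sqrt ((j : ℝ) + 1/2) / alphaC j *
      (Polynomial.derivative (legendrePoly.combination j)).eval x := by
  have h : qP j = fun x => Real.sqrt ((j : ℝ) + 1/2) / alphaC j *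
      (legendrePoly.combination j).eval x := by
    ext x
    have h5 : Real.sqrt (2 * (j:ℝ) + 5) =
        Real.sqrt 2 * Real.sqrt (((j + 2 : ℕ) : ℝ) + 1/2) := by
      rw [← sqrt_two_mul_add_one]
      push_cast
      ring_nf
    have h0 : Real.sqrt (((j + 2 : ℕ) : ℝ) + 1/2) ≠ 0 := by positivity
    rw [qP, legP_eq_eval_s6, legP_eq_eval_s6, betaC, h5, sqrt_two_mul_add_one,
      legendrePoly.combination, Polynomial.eval_sub, Polynomial.eval_mul, Polynomial.eval_C]
    field_simp
  rw [h, deriv_const_mul _ (Polynomial.differentiableAt _), Polynomial.deriv]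

theorem integral_deriv_qP_mul_deriv_qP (i j : ℕ) :
    ∫ x in (-1:ℝ)..1, deriv (qP i) x * deriv (qP j) x =
      (Real.sqrt ((i : ℝ) + 1/2) / alphaC i) * (Real.sqrt ((j : ℝ) + 1/2) / alphaC j) *
      ∫ x in (-1:ℝ)..1, (Polynomial.derivative (legendrePoly.combination i)).eval x *
        (Polynomial.derivative (legendrePoly.combination j)).eval x := by
  rw [← intervalIntegral.integral_const_mul]
  simp only [deriv_qP_s6, mul_mul_mul_comm]

/-- for `i, j ≥ 1` with `i ≠ j`, `∫_{−1}^{1} q_i' q_j' = 0`, and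
`∫_{−1}^{1} (q_j')² = (β_j √(2j+5) / (α_j² √(2j+1))) (2j+1)(2j+3)`. -/
theorem qP_stiffness (i j : ℕ) (hi : 1 ≤ i) (hj : 1 ≤ j) :
    (i ≠ j → (∫ x in (-1:ℝ)..1, deriv (qP i) x * deriv (qP j) x) = 0) ∧
      (∫ x in (-1:ℝ)..1, (deriv (qP j) x)^2) =
        (betaC j * Real.sqrt (2*(j:ℝ) + 5) / ((alphaC j)^2 * Real.sqrt (2*(j:ℝ) + 1))) *
          ((2*(j:ℝ) + 1) * (2*(j:ℝ) + 3)) := by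
  constructor
  · intro hij
    rw [integral_deriv_qP_mul_deriv_qP, legendrePoly.integral_derivative_combination_of_ne hi hj hij,
      mul_zero]
  · simp only [pow_two (deriv (qP j) _)]
    rw [integral_deriv_qP_mul_deriv_qP, legendrePoly.integral_derivative_combination_self hj,
      div_mul_div_comm, Real.mul_self_sqrt (by positivity), betaC]
    have h1 : Real.sqrt (2 * (j:ℝ) + 1) ≠ 0 := by positivity
    have h5 : Real.sqrt (2 * (j:ℝ) + 5) ≠ 0 := by positivity
    have hα : alphaC j ≠ 0 := by
      rw [alphaC]
      positivity
    field_simp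
    ring
end

section
/- For all integers m ≥ 1 and ν ≥ 1, the identity Σ_{ℓ=0}^{ν−1} (m + 2ℓ) ( (m)_ℓ / ℓ! )² = m ( (m+1)_{ν−1} / (ν−1)! )² holds. -/
/-- The rising factorial (Pochhammer symbol) `(a)_n = a(a+1)⋯(a+n−1)`, with `(a)_0 = 1`. -/
noncomputable def poch (a : ℝ) (n : ℕ) : ℝ := (ascPochhammer ℝ n).eval a

theorem poch_succ_left (a : ℝ) (n : ℕ) : poch a (n + 1) = a * poch (a + 1) n := by
  simp [poch, ascPochhammer_succ_left]

theorem poch_succ_right (a : ℝ) (n : ℕ) : poch a (n + 1) = poch a n * (a + n) :=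
  ascPochhammer_succ_eval n a

theorem sum_range_succ_poch_div_factorial_sq (a : ℝ) (n : ℕ) :
    ∑ ℓ ∈ Finset.range (n + 1), (a + 2 * (ℓ : ℝ)) * (poch a ℓ / (Nat.factorial ℓ : ℝ)) ^ 2 =
      a * (poch (a + 1) n / (Nat.factorial n : ℝ)) ^ 2 := by
  induction n with
  | zero => simp [poch]
  | succ n ih =>
    have hn : (Nat.factorial n : ℝ) ≠ 0 := by positivity
    rw [Finset.sum_range_succ, ih, poch_succ_left a, poch_succ_right (a + 1), Nat.factorial_succ]
    push_cast
    field_simp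
    ring

/-- for integers `m ≥ 1` and `ν ≥ 1`,
`Σ_{ℓ=0}^{ν−1} (m + 2ℓ) ((m)_ℓ / ℓ!)² = m ((m+1)_{ν−1} / (ν−1)!)²`. -/
theorem pochhammer_sum_identity (m ν : ℕ) (hm : 1 ≤ m) (hν : 1 ≤ ν) :
    ∑ ℓ ∈ Finset.range ν, ((m:ℝ) + 2*(ℓ:ℝ)) * (poch (m:ℝ) ℓ / (Nat.factorial ℓ : ℝ))^2 =
      (m:ℝ) * (poch ((m:ℝ) + 1) (ν - 1) / (Nat.factorial (ν - 1) : ℝ))^2 := by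
  obtain ⟨n, rfl⟩ := Nat.exists_eq_add_of_le' hν
  exact sum_range_succ_poch_div_factorial_sq m n
end

section
/- For all integers m ≥ 1 and i, j ≥ 1, ∫_0^1 r^{2m−1} P_{i−1}^{(0,m)}(2r² − 1) P_{j−1}^{(0,m)}(2r² − 1) dr = (−1)^{i+j} / (2m) · (min(i,j))_m / (max(i,j))_m. -/
open MeasureTheory intervalIntegral

/-- The Jacobi polynomial `P_n^{(0,m)}` via the Rodrigues formula
`P_n^{(0,m)}(x) = ((−1)ⁿ/(2ⁿ n!)) (1+x)^{−m} (d/dx)ⁿ [ (1−x)ⁿ (1+x)^{n+m} ]`. -/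
noncomputable def jacobi0 (n m : ℕ) (x : ℝ) : ℝ :=
  ((-1:ℝ)^n / ((2:ℝ)^n * (Nat.factorial n : ℝ))) *
    iteratedDeriv n (fun y : ℝ => (1 - y)^n * (1 + y)^(n + m)) x / (1 + x)^m

/-- `μ_j^m = 2√(j + (m−1)/2)`. -/
noncomputable def muC (j m : ℕ) : ℝ := 2 * Real.sqrt ((j:ℝ) + ((m:ℝ) - 1)/2)

/-- The radial polynomial `h_j^m(r) = μ_j^m r^m P_{j−1}^{(0,m)}(2r² − 1)`. -/
noncomputable def hRad (j m : ℕ) (r : ℝ) : ℝ :=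
  muC j m * r^m * jacobi0 (j - 1) m (2*r^2 - 1)

/-- `∏_{s=1}^{n} (X + s)`. -/
noncomputable def shiftedRising (n : ℕ) : Polynomial ℝ :=
  ∏ s ∈ Finset.range n, (Polynomial.X + Polynomial.C ((s : ℝ) + 1))

lemma shiftedRising_natDegree (n : ℕ) : (shiftedRising n).natDegree = n := by
  unfold shiftedRising
  rw [Polynomial.natDegree_prod_of_monic _ _ fun s _ => Polynomial.monic_X_add_C _]
  simp only [Polynomial.natDegree_X_add_C]
  simp

lemma shiftedRising_eval_nat (n k : ℕ) :
    (shiftedRising n).eval (k : ℝ) = ((k + 1).ascFactorial n : ℝ) := by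
  simp only [shiftedRising, Polynomial.eval_prod, Polynomial.eval_add, Polynomial.eval_X,
    Polynomial.eval_C]
  induction n with
  | zero => simp
  | succ n ih =>
    rw [Finset.prod_range_succ, ih, Nat.ascFactorial_succ]
    push_cast
    ring

lemma shiftedRising_eval_neg (n a : ℕ) (h1 : 1 ≤ a) (h2 : a ≤ n) :
    (shiftedRising n).eval (-(a : ℝ)) = 0 := by
  simp only [shiftedRising, Polynomial.eval_prod, Polynomial.eval_add, Polynomial.eval_X,
    Polynomial.eval_C]
  refine Finset.prod_eq_zero (i := a - 1) (by simp; omega) ?_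
  push_cast [Nat.cast_sub h1]
  ring

/-- The alternating binomial sum of `f` along `x, x + 1, …, x + n`. -/
noncomputable def altBinomSum (n : ℕ) (f : ℝ → ℝ) (x : ℝ) : ℝ :=
  ∑ l ∈ Finset.range (n + 1), (-1 : ℝ) ^ l * n.choose l * f (x + l)

lemma altBinomSum_eq_fwdDiff (n : ℕ) (f : ℝ → ℝ) (x : ℝ) :
    altBinomSum n f x = (-1) ^ n * (fwdDiff (1 : ℝ))^[n] f x := by
  rw [fwdDiff_iter_eq_sum_shift, altBinomSum, Finset.mul_sum]
  refine Finset.sum_congr rfl fun l hl => ?_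
  have hl : l ≤ n := by simpa [Nat.lt_succ_iff] using hl
  obtain ⟨d, rfl⟩ := Nat.exists_eq_add_of_le hl
  have h : ((-1 : ℝ) ^ d) * (-1) ^ d = 1 := by rw [← mul_pow]; simp
  simp only [Nat.add_sub_cancel_left, zsmul_eq_mul, nsmul_eq_mul, mul_one]
  push_cast
  rw [pow_add]
  linear_combination (-(-1 : ℝ) ^ l * ((l + d).choose l) * f (x + l)) * h

lemma altBinomSum_polynomial (n : ℕ) (P : Polynomial ℝ) (hP : P.natDegree < n) (x : ℝ) :
    altBinomSum n P.eval x = 0 := by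
  rw [altBinomSum_eq_fwdDiff, Polynomial.fwdDiff_iter_eq_zero_of_degree_lt hP]
  simp

lemma fwdDiff_iter_inv (n : ℕ) (x : ℝ) (hx : 0 < x) :
    (fwdDiff (1 : ℝ))^[n] (fun y => y⁻¹) x =
      (-1) ^ n * n.factorial / ∏ s ∈ Finset.range (n + 1), (x + s) := by
  induction n generalizing x with
  | zero => simp
  | succ n ih =>
    rw [Function.iterate_succ_apply', fwdDiff, ih x hx, ih (x + 1) (by linarith)]
    have h1 : ∏ s ∈ Finset.range (n + 1 + 1), (x + s) =
        (∏ s ∈ Finset.range (n + 1), (x + s)) * (x + (n + 1)) := by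
      rw [Finset.prod_range_succ]; push_cast; ring
    have h2 : ∏ s ∈ Finset.range (n + 1 + 1), (x + s) =
        (∏ s ∈ Finset.range (n + 1), (x + 1 + s)) * x := by
      rw [Finset.prod_range_succ']
      push_cast
      rw [add_zero]
      congr 1
      exact Finset.prod_congr rfl fun s _ => by ring
    have hA : 0 < ∏ s ∈ Finset.range (n + 1), (x + (s : ℝ)) :=
      Finset.prod_pos fun s _ => by positivity
    have hB : 0 < ∏ s ∈ Finset.range (n + 1), (x + 1 + (s : ℝ)) :=
      Finset.prod_pos fun s _ => by positivity
    rw [h1] at h2 ⊢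
    set A := ∏ s ∈ Finset.range (n + 1), (x + (s : ℝ))
    set B := ∏ s ∈ Finset.range (n + 1), (x + 1 + (s : ℝ))
    have hxn : 0 < x + ((n : ℝ) + 1) := by positivity
    rw [Nat.factorial_succ, div_sub_div _ _ hB.ne' hA.ne',
      div_eq_div_iff (by positivity) (by positivity)]
    push_cast
    have hB' : B = A * (x + (n + 1)) / x := by rw [h2]; field_simp
    rw [hB']
    field_simp
    ring

lemma altBinomSum_div (n : ℕ) (P : Polynomial ℝ) (hP : P.natDegree ≤ n) (a x : ℝ)
    (hx : 0 < x + a) :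
    altBinomSum n (fun y => P.eval y / (y + a)) x * ∏ s ∈ Finset.range (n + 1), (x + a + s) =
      P.eval (-a) * n.factorial := by
  have hprod : 0 < ∏ s ∈ Finset.range (n + 1), (x + a + (s : ℝ)) :=
    Finset.prod_pos fun s _ => by positivity
  have hdiv := Polynomial.modByMonic_add_div P (Polynomial.X - Polynomial.C (-a))
  rw [Polynomial.modByMonic_X_sub_C_eq_C_eval] at hdiv
  have hdeg := Polynomial.natDegree_divByMonic P (Polynomial.monic_X_sub_C (-a))
  rw [Polynomial.natDegree_X_sub_C] at hdeg
  set Q := P /ₘ (Polynomial.X - Polynomial.C (-a))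
  have hsplit : altBinomSum n (fun y => P.eval y / (y + a)) x =
      P.eval (-a) * altBinomSum n (fun y => y⁻¹) (x + a) + altBinomSum n Q.eval x := by
    simp only [altBinomSum, Finset.mul_sum, ← Finset.sum_add_distrib]
    refine Finset.sum_congr rfl fun l _ => ?_
    have hne : x + l + a ≠ 0 := by
      have : (0 : ℝ) ≤ l := by positivity
      linarith
    have he : P.eval (x + l) = P.eval (-a) + (x + l + a) * Q.eval (x + l) := by
      conv_lhs => rw [← hdiv]
      simp
    rw [he, add_right_comm x a]
    field_simp
  have hQ : altBinomSum n Q.eval x = 0 := by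
    rcases Nat.eq_zero_or_pos n with rfl | hn
    · have : Q = 0 := by
        refine (Polynomial.divByMonic_eq_zero_iff (Polynomial.monic_X_sub_C (-a))).2 ?_
        rw [Polynomial.degree_X_sub_C]
        exact lt_of_le_of_lt (Polynomial.natDegree_le_iff_degree_le.1 hP) (by norm_num)
      simp [altBinomSum, this]
    · exact altBinomSum_polynomial n Q (by omega) x
  rw [hsplit, hQ, altBinomSum_eq_fwdDiff, fwdDiff_iter_inv n _ hx, add_zero]
  have h : ((-1 : ℝ) ^ n) * (-1) ^ n = 1 := by rw [← mul_pow]; simp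
  field_simp
  linear_combination P.eval (-a) * h

/-- The coefficient of `r^{2l}` in `P_n^{(0,m)}(2r² − 1)`. -/
noncomputable def radialCoeff (n m l : ℕ) : ℝ :=
  (-1) ^ n / n.factorial * ((-1) ^ l * n.choose l * (shiftedRising n).eval ((m : ℝ) + l))

lemma jacobi0_eq_sum_radialCoeff (n m : ℕ) (r : ℝ) (hr : r ≠ 0) :
    jacobi0 n m (2 * r ^ 2 - 1) =
      ∑ l ∈ Finset.range (n + 1), radialCoeff n m l * r ^ (2 * l) := by
  have hexp : (fun y : ℝ => (1 - y) ^ n * (1 + y) ^ (n + m)) = fun y =>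
      ∑ l ∈ Finset.range (n + 1),
        ((-1) ^ l * 2 ^ (n - l) * n.choose l : ℝ) * (1 + y) ^ (n + m + l) := by
    funext y
    have : 1 - y = -(1 + y) + 2 := by ring
    rw [this, add_pow, Finset.sum_mul]
    refine Finset.sum_congr rfl fun l _ => ?_
    rw [neg_pow, pow_add _ (n + m) l]
    ring
  have hder (k : ℕ) (x : ℝ) : iteratedDeriv n (fun y : ℝ => (1 + y) ^ k) x =
      k.descFactorial n * (1 + x) ^ (k - n) := by
    rw [iteratedDeriv_comp_const_add n (fun z : ℝ => z ^ k) 1]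
    exact iteratedDeriv_pow k n
  rw [jacobi0, hexp, iteratedDeriv_fun_sum fun l _ => by fun_prop, Finset.mul_sum,
    Finset.sum_div]
  refine Finset.sum_congr rfl fun l hl => ?_
  have hl : l ≤ n := by simpa [Nat.lt_succ_iff] using hl
  rw [iteratedDeriv_const_mul_field, hder, radialCoeff]
  have h1 : n + m + l - n = m + l := by omega
  have h2 : n + m + l = m + l + n := by omega
  have h3 : (1 : ℝ) + (2 * r ^ 2 - 1) = 2 * r ^ 2 := by ring
  have h4 := shiftedRising_eval_nat n (m + l)
  have h5 : (2 : ℝ) ^ n = 2 ^ (n - l) * 2 ^ l := by rw [← pow_add]; congr 1; omega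
  push_cast at h4
  rw [h1, h2, Nat.add_descFactorial_eq_ascFactorial, h3, h4, h5, pow_add (2 * r ^ 2) m l,
    mul_pow 2 (r ^ 2) l, pow_mul]
  field_simp

lemma integral_pow_mul_jacobi0 (m n k : ℕ) (hm : 1 ≤ m) :
    (∫ r in (0:ℝ)..1, r^(2*m - 1) * jacobi0 n m (2*r^2 - 1) * jacobi0 k m (2*r^2 - 1)) =
      ∑ a ∈ Finset.range (k + 1), radialCoeff k m a * ((-1) ^ n / n.factorial / 2 *
        altBinomSum n (fun y => (shiftedRising n).eval y / (y + a)) m) := by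
  have hcongr : (∫ r in (0:ℝ)..1,
        r^(2*m - 1) * jacobi0 n m (2*r^2 - 1) * jacobi0 k m (2*r^2 - 1)) =
      ∫ r in (0:ℝ)..1, ∑ a ∈ Finset.range (k + 1), ∑ l ∈ Finset.range (n + 1),
        radialCoeff k m a * radialCoeff n m l * r ^ (2 * (m + l + a) - 1) := by
    refine intervalIntegral.integral_congr_ae (Filter.Eventually.of_forall fun r hr => ?_)
    rw [Set.uIoc_of_le zero_le_one] at hr
    rw [jacobi0_eq_sum_radialCoeff n m r hr.1.ne', jacobi0_eq_sum_radialCoeff k m r hr.1.ne',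
      Finset.mul_sum]
    refine Finset.sum_congr rfl fun a _ => ?_
    rw [Finset.mul_sum, Finset.sum_mul]
    refine Finset.sum_congr rfl fun l _ => ?_
    have : 2 * (m + l + a) - 1 = (2 * m - 1) + 2 * l + 2 * a := by omega
    rw [this, pow_add, pow_add]
    ring
  rw [hcongr, intervalIntegral.integral_finsetSum fun a _ =>
    Continuous.intervalIntegrable (by fun_prop) _ _]
  refine Finset.sum_congr rfl fun a _ => ?_
  rw [intervalIntegral.integral_finsetSum fun l _ =>
    Continuous.intervalIntegrable (by fun_prop) _ _]
  simp only [altBinomSum, Finset.mul_sum]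
  refine Finset.sum_congr rfl fun l _ => ?_
  have hm' : (0 : ℝ) < m := by exact_mod_cast hm
  rw [intervalIntegral.integral_const_mul, integral_pow, Nat.cast_sub (by omega)]
  simp only [radialCoeff]
  have hexp : 2 * (m + l + a) - 1 + 1 ≠ 0 := by omega
  rw [one_pow, zero_pow hexp]
  push_cast
  have : (0 : ℝ) < m + l + a := by positivity
  have h2 : (2 * ((m : ℝ) + l + a) - 1 + 1) = 2 * (m + l + a) := by ring
  rw [h2]
  field_simp
  ring

lemma poch_succ_mul_factorial (k m : ℕ) :
    (k.factorial : ℝ) * poch ((k + 1 : ℕ) : ℝ) m = (k + m).factorial := by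
  rw [poch, ← ascPochhammer_eval_cast, ascPochhammer_nat_eq_ascFactorial]
  exact_mod_cast Nat.factorial_mul_ascFactorial k m

lemma integral_pow_mul_jacobi0_of_le (m n k : ℕ) (hm : 1 ≤ m) (hk : k ≤ n) :
    (∫ r in (0:ℝ)..1, r^(2*m - 1) * jacobi0 n m (2*r^2 - 1) * jacobi0 k m (2*r^2 - 1)) =
      (-1:ℝ)^(n + k) / (2*(m:ℝ)) *
        (poch ((k + 1 : ℕ) : ℝ) m / poch ((n + 1 : ℕ) : ℝ) m) := by
  have hm' : (0 : ℝ) < m := by exact_mod_cast hm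
  rw [integral_pow_mul_jacobi0 m n k hm, Finset.sum_eq_single 0]
  · have h := altBinomSum_div n (shiftedRising n) (shiftedRising_natDegree n).le 0 m (by simpa)
    have h0 : (shiftedRising n).eval (-(0 : ℝ)) = n.factorial := by
      have := shiftedRising_eval_nat n 0
      simpa [Nat.one_ascFactorial] using this
    have hprod : ∏ s ∈ Finset.range (n + 1), ((m : ℝ) + 0 + s) =
        m * ((m + 1).ascFactorial n : ℝ) := by
      rw [← shiftedRising_eval_nat, Finset.prod_range_succ', mul_comm]
      simp [shiftedRising, Polynomial.eval_prod]
    rw [h0, hprod] at h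
    have hn1 : (m.factorial : ℝ) * ((m + 1).ascFactorial n : ℝ) = (m + n).factorial := by
      exact_mod_cast Nat.factorial_mul_ascFactorial m n
    have hk1 : (m.factorial : ℝ) * ((m + 1).ascFactorial k : ℝ) = (m + k).factorial := by
      exact_mod_cast Nat.factorial_mul_ascFactorial m k
    have hn2 := poch_succ_mul_factorial n m
    have hk2 := poch_succ_mul_factorial k m
    rw [add_comm n m, ← hn1] at hn2
    rw [add_comm k m, ← hk1] at hk2
    have hk3 := shiftedRising_eval_nat k m
    simp only [radialCoeff, Nat.cast_zero, add_zero] at h ⊢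
    rw [hk3]
    have hA : (0 : ℝ) < ((m + 1).ascFactorial n : ℝ) := by
      exact_mod_cast Nat.ascFactorial_pos _ _
    have hfm : (0 : ℝ) < m.factorial := by exact_mod_cast Nat.factorial_pos m
    have hfn : (0 : ℝ) < n.factorial := by exact_mod_cast Nat.factorial_pos n
    have hfk : (0 : ℝ) < k.factorial := by exact_mod_cast Nat.factorial_pos k
    rw [eq_div_of_mul_eq (by positivity) h,
      eq_div_of_mul_eq hfn.ne' ((mul_comm _ _).trans hn2),
      eq_div_of_mul_eq hfk.ne' ((mul_comm _ _).trans hk2), pow_add]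
    simp only [pow_zero, Nat.choose_zero_right, Nat.cast_one]
    field_simp
  · intro a ha ha0
    have hak : a ≤ k := by simpa [Nat.lt_succ_iff] using ha
    have h := altBinomSum_div n (shiftedRising n) (shiftedRising_natDegree n).le a m
      (by positivity)
    rw [shiftedRising_eval_neg n a (by omega) (by omega), zero_mul] at h
    have hprod : ∏ s ∈ Finset.range (n + 1), ((m : ℝ) + a + s) ≠ 0 :=
      (Finset.prod_pos fun s _ => by positivity).ne'
    rw [(mul_eq_zero.1 h).resolve_right hprod]
    simp
  · simp

/-- for `m ≥ 1` and `i, j ≥ 1`,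
`∫_0^1 r^{2m−1} P_{i−1}^{(0,m)}(2r²−1) P_{j−1}^{(0,m)}(2r²−1) dr
  = (−1)^{i+j}/(2m) · (min(i,j))_m / (max(i,j))_m`. -/
theorem jacobi0_weighted_integral (m i j : ℕ) (hm : 1 ≤ m) (hi : 1 ≤ i) (hj : 1 ≤ j) :
    (∫ r in (0:ℝ)..1, r^(2*m - 1) * jacobi0 (i - 1) m (2*r^2 - 1) * jacobi0 (j - 1) m (2*r^2 - 1)) =
      (-1:ℝ)^(i + j) / (2*(m:ℝ)) * (poch (min i j : ℕ) m / poch (max i j : ℕ) m) := by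
  obtain ⟨n, rfl⟩ := Nat.exists_eq_add_of_le' hi
  obtain ⟨k, rfl⟩ := Nat.exists_eq_add_of_le' hj
  have hsign : (-1 : ℝ) ^ (n + 1 + (k + 1)) = (-1) ^ (n + k) := by ring
  simp only [Nat.add_sub_cancel]
  rw [hsign]
  rcases le_total k n with h | h
  · rw [min_eq_right (by omega), max_eq_left (by omega)]
    exact integral_pow_mul_jacobi0_of_le m n k hm h
  · rw [min_eq_left (by omega), max_eq_right (by omega), add_comm n k,
      ← integral_pow_mul_jacobi0_of_le m k n hm h]
    exact intervalIntegral.integral_congr fun r _ => by ring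
end
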